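/- With the setup below, Σ_{i=1}^{m(n)} [ −B₁(x_i(n))·B₁(x_{i−1}(n)) + (b_i(n)/2)·B₂(x_i(n)) ] = (1/12)·( A(r) + k·B(r) ), where A(r) = Σ_{l=1}^{t} [ −12·B₁(ν_{Γ_l(r)}(r))·B₁(ν_{Γ_l(r)−1}(r)) + 6·(a_{2l}(r) + 2)·B₂(ν_{Γ_l(r)}(r)) ] + Σ_{l=0}^{t−1} [ 6·( (γ_{2l+1}(r) − 1)·d_l(r)² + (1 − 2d_l(r))·[ν_{Γ_l(r)}(r) + d_l(r)·(γ_{2l+1}(r) − 1)]₁ + B₂(ν_{Γ_{l+1}(r)−1}(r)) − B₂(ν_{Γ_l(r)}(r)) ) − γ_{2l+1}(r) + 1 + τ_{2l+1}(r)·( 6·( q·d_l(r)² + (1 − 2d_l(r))·[ν_{Γ_l(r)}(r) + d_l(r)·q]₁ ) − q ) ], and B(r) = Σ_{l=1}^{t} 6q·α_{2l}·B₂(ν_{Γ_l(r)}(r)) + Σ_{l=0}^{t−1} α_{2l+1}·( 6·( q·d_l(r)² + (1 − 2d_l(r))·[ν_{Γ_l(r)}(r) + d_l(r)·q]₁ )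 − q ). -/

import Mathlib

/-- `⟨x⟩`: the unique element of `(0,1]` congruent to `x` modulo `ℤ`. -/
noncomputable def ufrac (x : ℝ) : ℝ := x - ⌈x⌉ + 1

/-- `[x]₁ := x - ⟨x⟩`. -/
noncomputable def ipart (x : ℝ) : ℝ := x - ufrac x

/-- The first Bernoulli polynomial `B₁(x) = x - 1/2`. -/
noncomputable def B1 (x : ℝ) : ℝ := x - 1/2

/-- The second Bernoulli polynomial `B₂(x) = x² - x + 1/6`. -/
noncomputable def B2 (x : ℝ) : ℝ := x^2 - x + 1/6

lemma ufrac_pos (x : ℝ) : 0 < ufrac x := by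
  have := Int.ceil_lt_add_one x
  unfold ufrac; linarith

lemma ufrac_le_one (x : ℝ) : ufrac x ≤ 1 := by
  have := Int.le_ceil x
  unfold ufrac; linarith

lemma ufrac_add_intCast (x : ℝ) (z : ℤ) : ufrac (x + z) = ufrac x := by
  unfold ufrac
  rw [Int.ceil_add_intCast]; push_cast; ring

lemma ufrac_eq_of_sub_eq_intCast {x y : ℝ} {z : ℤ} (h : x - y = z) : ufrac x = ufrac y := by
  rw [← ufrac_add_intCast y z, ← h, add_sub_cancel]

lemma ufrac_eq_self {x : ℝ} (h0 : 0 < x) (h1 : x ≤ 1) : ufrac x = x := by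
  have : ⌈x⌉ = 1 := Int.ceil_eq_iff.2 ⟨by push_cast; linarith, by exact_mod_cast h1⟩
  unfold ufrac; rw [this]; push_cast; ring

lemma exists_ufrac_eq_sub_intCast (x : ℝ) : ∃ z : ℤ, ufrac x = x - z :=
  ⟨⌈x⌉ - 1, by unfold ufrac; push_cast; ring⟩

/-- The step from `⟨u⟩` to `⟨u + d⟩` wraps around either not at all or once. -/
lemma ufrac_add_wrap (u : ℝ) {d : ℝ} (h0 : 0 < d) (h1 : d ≤ 1) :
    ufrac (u + d) = ufrac u + d ∨ ufrac (u + d) = ufrac u + d - 1 := by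
  obtain ⟨z, hz⟩ := exists_ufrac_eq_sub_intCast u
  obtain ⟨w, hw⟩ := exists_ufrac_eq_sub_intCast (u + d)
  have a1 := ufrac_pos u
  have a2 := ufrac_le_one u
  have a3 := ufrac_pos (u + d)
  have a4 := ufrac_le_one (u + d)
  have l1 : ((-1 : ℤ) : ℝ) < ((w - z : ℤ) : ℝ) := by push_cast; linarith
  have l2 : ((w - z : ℤ) : ℝ) < ((2 : ℤ) : ℝ) := by push_cast; linarith
  have l1' := Int.cast_lt.1 l1
  have l2' := Int.cast_lt.1 l2
  obtain h | h : w = z ∨ w = z + 1 := by omega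
  · left; rw [hw, hz, h]; ring
  · right; rw [hw, hz, h]; push_cast; ring

lemma sum_arith_progression (u : ℝ) {d : ℝ} (hd0 : 0 < d) (hd1 : d ≤ 1)
    (y : ℕ → ℝ) (hy0 : y 0 = u) (hu0 : 0 < u) (hu1 : u ≤ 1) (N : ℕ)
    (hy : ∀ j ≤ N, y j = ufrac (u + j * d)) :
    ∑ j ∈ Finset.range N, (-(B1 (y (j+1)) * B1 (y j)) + B2 (y (j+1)))
      = (1/12) * (6 * (N * d^2 + (1 - 2 * d) * ipart (u + N * d) + B2 (y N) - B2 u) - N) := by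
  induction N with
  | zero => simp [hy0, ipart, ufrac_eq_self hu0 hu1]
  | succ N ih =>
    rw [Finset.sum_range_succ, ih fun j hj => hy j (by omega)]
    have e : u + ((N + 1 : ℕ) : ℝ) * d = u + N * d + d := by push_cast; ring
    have h1 := hy (N+1) le_rfl
    rw [e] at h1 ⊢
    have h2 := hy N (by omega)
    rw [ipart, ipart, ← h1, ← h2]
    rcases ufrac_add_wrap (u + N * d) hd0 hd1 with h | h <;> rw [← h1, ← h2] at h <;>
      rw [h] <;> push_cast <;> unfold B1 B2 <;> ring

/-- A linear recurrence `x_{i+1} = ⟨b_i x_i - x_{i-1}⟩` with integer coefficients keeps its values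
in `(0,1] ∩ (1/q)ℤ`. -/
lemma recurrence_values {q : ℕ} {b : ℤ → ℤ} {x : ℤ → ℝ}
    (hm1 : ∃ z : ℤ, q * x (-1) = z) (h0 : ∃ z : ℤ, q * x 0 = z)
    (hp : 0 < x 0) (hl : x 0 ≤ 1)
    (hrec : ∀ i : ℤ, 0 ≤ i → x (i+1) = ufrac ((b i : ℝ) * x i - x (i-1))) (i : ℤ) (hi : 0 ≤ i) :
    0 < x i ∧ x i ≤ 1 ∧ ∃ z : ℤ, q * x i = z := by
  have key : ∀ j : ℕ, (∃ z : ℤ, q * x ((j:ℤ) - 1) = z) ∧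
      0 < x j ∧ x j ≤ 1 ∧ ∃ z : ℤ, q * x j = z := by
    intro j
    induction j with
    | zero => simpa using ⟨hm1, hp, hl, h0⟩
    | succ j ih =>
      obtain ⟨⟨z, hz⟩, -, -, w, hw⟩ := ih
      have e := hrec j (by omega)
      push_cast
      rw [add_sub_cancel_right, e]
      refine ⟨⟨w, hw⟩, ufrac_pos _, ufrac_le_one _, ?_⟩
      obtain ⟨v, hv⟩ := exists_ufrac_eq_sub_intCast ((b j : ℝ) * x j - x (j-1))
      refine ⟨b j * w - z - q * v, ?_⟩
      rw [hv]; push_cast; rw [← hz, ← hw]; ring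
  obtain ⟨j, rfl⟩ := Int.eq_ofNat_of_zero_le hi
  exact (key j).2

/-- Where the coefficients are `2`, the recurrence is an arithmetic progression modulo `1`. -/
lemma recurrence_segment {b : ℤ → ℤ} {x : ℤ → ℝ}
    (hrec : ∀ i : ℤ, 0 ≤ i → x (i+1) = ufrac ((b i : ℝ) * x i - x (i-1)))
    {p : ℤ} (hp : 0 ≤ p) (hx0 : 0 < x p) (hx1 : x p ≤ 1) {a : ℤ}
    (hb : ∀ i, p < i → i < p + a → b i = 2) {d : ℝ} (hd : d = ufrac (x (p+1) - x p)) (j : ℕ)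
    (hj : (j : ℤ) ≤ a) : x (p + j) = ufrac (x p + j * d) := by
  obtain ⟨v, hv⟩ := exists_ufrac_eq_sub_intCast (x (p+1) - x p)
  rw [← hd] at hv
  induction j using Nat.strong_induction_on with
  | _ j ih =>
    match j with
    | 0 => simp [ufrac_eq_self hx0 hx1]
    | 1 =>
      have h := hrec p hp
      have : ufrac (x (p+1)) = x (p+1) := by
        rw [h]; exact ufrac_eq_self (ufrac_pos _) (ufrac_le_one _)
      push_cast
      rw [← this]
      refine ufrac_eq_of_sub_eq_intCast (z := v) ?_
      rw [hv]; ring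
    | j+2 =>
      have h1 := ih (j+1) (by omega) (by push_cast at hj ⊢; omega)
      have h2 := ih j (by omega) (by push_cast at hj ⊢; omega)
      have h := hrec (p + (j+1 : ℕ)) (by omega)
      rw [hb _ (by push_cast; omega) (by push_cast at hj ⊢; omega)] at h
      have e1 : p + ((j+1 : ℕ) : ℤ) + 1 = p + ((j+2 : ℕ) : ℤ) := by push_cast; ring
      have e2 : p + ((j+1 : ℕ) : ℤ) - 1 = p + (j : ℤ) := by push_cast; ring
      rw [e1, e2, h1, h2] at h
      rw [h]
      obtain ⟨z, hz⟩ := exists_ufrac_eq_sub_intCast (x p + (j+1 : ℕ) * d)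
      obtain ⟨w, hw⟩ := exists_ufrac_eq_sub_intCast (x p + j * d)
      refine ufrac_eq_of_sub_eq_intCast (z := w - 2 * z) ?_
      rw [hz, hw]; push_cast; ring

lemma sum_Icc_one_add (f : ℤ → ℝ) {p : ℤ} (hp : 0 ≤ p) (N : ℕ) :
    ∑ i ∈ Finset.Icc 1 (p + N), f i
      = ∑ i ∈ Finset.Icc 1 p, f i + ∑ j ∈ Finset.range N, f (p + j + 1) := by
  induction N with
  | zero => simp
  | succ N ih =>
    have : Finset.Icc 1 (p + ((N+1 : ℕ) : ℤ)) = insert (p + N + 1) (Finset.Icc 1 (p + N)) := by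
      ext i; simp only [Finset.mem_Icc, Finset.mem_insert]; push_cast; omega
    rw [this, Finset.sum_insert (by simp), ih, Finset.sum_range_succ]
    ring

/-- Between consecutive breakpoints of an increasing sequence there are no breakpoints. -/
lemma not_breakpoint {S a : ℕ → ℤ} (ha : ∀ j, 1 ≤ a j) (hS : ∀ j, S (j+1) = S j + a j)
    (l : ℕ) (i : ℤ) (h1 : S l < i) (h2 : i < S l + a l) : ¬ ∃ j, i = S j := by
  have hmono : StrictMono S := strictMono_nat_of_lt_succ fun j => by
    rw [hS]; have := ha j; omega
  rintro ⟨j, rfl⟩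
  rw [← hS] at h2
  have := hmono.lt_iff_lt.1 h1
  have := hmono.lt_iff_lt.1 h2
  omega

lemma breakpoint_nonneg {S a : ℕ → ℤ} (ha : ∀ j, 1 ≤ a j) (hS0 : S 0 = 0)
    (hS : ∀ j, S (j+1) = S j + a j) (l : ℕ) : 0 ≤ S l := by
  induction l with
  | zero => exact hS0.ge
  | succ l ih => rw [hS]; have := ha l; omega

/-- The value of a progression modulo `1` with `q`-torsion step depends on the index mod `q`. -/
lemma ufrac_add_mul_congr {q : ℕ} {d : ℝ} (hd : ∃ z : ℤ, q * d = z) (u : ℝ) (e g : ℝ) (w : ℤ)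
    (h : e = q * w + g) : ufrac (u + e * d) = ufrac (u + g * d) := by
  obtain ⟨z, hz⟩ := hd
  refine ufrac_eq_of_sub_eq_intCast (z := w * z) ?_
  rw [h]; push_cast; rw [← hz]; ring

/-- Linearity of `Σ_{i=1}^{m(n)} [-B₁(x_i(n))B₁(x_{i-1}(n)) + (b_i(n)/2)B₂(x_i(n))]`
in `k` for `n = qk + r`, with the explicit coefficients `A(r)` and `B(r)`. -/
theorem stmt_17 (q : ℕ) (hq : 0 < q) (C D : ℤ)
    (hC : 0 ≤ C) (hCq : C ≤ (q:ℤ) - 1) (hD : 0 ≤ D) (hDq : D ≤ (q:ℤ) - 1)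
    (s : ℕ) (hs : 1 ≤ s) (α β : ℕ → ℤ)
    (hαper : ∀ i, α (i + s) = α i) (hβper : ∀ i, β (i + s) = β i)
    (r : ℕ) (hr : r ≤ q - 1) (k : ℕ) (n : ℕ) (hn : n = q * k + r)
    (t : ℕ) (htodd : Odd s → t = s) (hteven : Even s → 2 * t = s)
    (han : ∀ i : ℕ, 1 ≤ α i * n + β i)
    (γ τ : ℕ → ℤ) (hγ1 : ∀ i, 1 ≤ γ i) (hγq : ∀ i, γ i ≤ (q:ℤ))
    (hγτ : ∀ i, α i * r + β i = (q:ℤ) * τ i + γ i)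
    (hγa : ∀ i, γ i ≤ α i * n + β i)
    (S Γ' : ℕ → ℤ)
    (hS0 : S 0 = 0) (hSrec : ∀ j : ℕ, S (j+1) = S j + (α (2*j+1) * n + β (2*j+1)))
    (hΓ0 : Γ' 0 = 0) (hΓrec : ∀ j : ℕ, Γ' (j+1) = Γ' j + γ (2*j+1))
    (m : ℤ) (hm : m = S t)
    (b c : ℤ → ℤ)
    (hbS : ∀ i : ℤ, 0 ≤ i → ∀ j : ℕ, i = S j → b i = (α (2*j) * n + β (2*j)) + 2)
    (hbn : ∀ i : ℤ, 0 ≤ i → (¬ ∃ j : ℕ, i = S j) → b i = 2)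
    (hcΓ : ∀ i : ℤ, 0 ≤ i → ∀ j : ℕ, i = Γ' j → c i = γ (2*j) + 2)
    (hcn : ∀ i : ℤ, 0 ≤ i → (¬ ∃ j : ℕ, i = Γ' j) → c i = 2)
    (x ν : ℤ → ℝ)
    (hxm1 : x (-1) = 1 - (C:ℝ)/q) (hx0 : x 0 = ufrac ((D:ℝ)/q))
    (hxrec : ∀ i : ℤ, 0 ≤ i → x (i+1) = ufrac ((b i : ℝ) * x i - x (i-1)))
    (hνm1 : ν (-1) = 1 - (C:ℝ)/q) (hν0 : ν 0 = ufrac ((D:ℝ)/q))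
    (hνrec : ∀ i : ℤ, 0 ≤ i → ν (i+1) = ufrac ((c i : ℝ) * ν i - ν (i-1)))
    (d : ℕ → ℝ) (hd : ∀ l : ℕ, d l = ufrac (ν (Γ' l + 1) - ν (Γ' l))) :
    ∑ i ∈ Finset.Icc (1:ℤ) m, (-(B1 (x i) * B1 (x (i-1))) + (b i : ℝ)/2 * B2 (x i))
      = (1/12) *
        (∑ l ∈ Finset.Icc 1 t,
            (-12 * B1 (ν (Γ' l)) * B1 (ν (Γ' l - 1))
              + 6 * (((α (2*l) * r + β (2*l) : ℤ) : ℝ) + 2) * B2 (ν (Γ' l)))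
          + ∑ l ∈ Finset.range t,
            (6 * (((γ (2*l+1) : ℝ) - 1) * (d l)^2
                  + (1 - 2 * d l) * ipart (ν (Γ' l) + d l * ((γ (2*l+1) : ℝ) - 1))
                  + B2 (ν (Γ' (l+1) - 1)) - B2 (ν (Γ' l)))
              - (γ (2*l+1) : ℝ) + 1
              + (τ (2*l+1) : ℝ) *
                  (6 * ((q:ℝ) * (d l)^2
                    + (1 - 2 * d l) * ipart (ν (Γ' l) + d l * q)) - q))
          + (k : ℝ) *
            (∑ l ∈ Finset.Icc 1 t, 6 * (q:ℝ) * (α (2*l) : ℝ) * B2 (ν (Γ' l))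
              + ∑ l ∈ Finset.range t,
                (α (2*l+1) : ℝ) *
                  (6 * ((q:ℝ) * (d l)^2
                    + (1 - 2 * d l) * ipart (ν (Γ' l) + d l * q)) - q))) := by
  have hq0 : (q : ℝ) ≠ 0 := by exact_mod_cast hq.ne'
  have hn' : (n : ℤ) = q * k + r := by exact_mod_cast hn
  have haγ : ∀ i, α i * n + β i = q * (τ i + k * α i) + γ i := fun i => by
    rw [hn']; linear_combination hγτ i
  have hSpos := breakpoint_nonneg (fun j => han (2*j+1)) hS0 hSrec
  have hΓpos := breakpoint_nonneg (fun j => hγ1 (2*j+1)) hΓ0 hΓrec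
  have hm1 : ∃ z : ℤ, q * (1 - (C:ℝ)/q) = z := ⟨q - C, by push_cast; field_simp⟩
  have h0 : ∃ z : ℤ, q * ufrac ((D:ℝ)/q) = z := by
    obtain ⟨z, hz⟩ := exists_ufrac_eq_sub_intCast ((D:ℝ)/q)
    exact ⟨D - q * z, by rw [hz]; push_cast; field_simp⟩
  have hxval := recurrence_values (hxm1 ▸ hm1) (hx0 ▸ h0) (hx0 ▸ ufrac_pos _)
    (hx0 ▸ ufrac_le_one _) hxrec
  have hνval := recurrence_values (hνm1 ▸ hm1) (hν0 ▸ h0) (hν0 ▸ ufrac_pos _)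
    (hν0 ▸ ufrac_le_one _) hνrec
  have hd0 : ∀ l, 0 < d l := fun l => hd l ▸ ufrac_pos _
  have hd1 : ∀ l, d l ≤ 1 := fun l => hd l ▸ ufrac_le_one _
  have hdq : ∀ l, ∃ z : ℤ, q * d l = z := fun l => by
    obtain ⟨-, -, z, hz⟩ := hνval (Γ' l) (hΓpos l)
    obtain ⟨-, -, w, hw⟩ := hνval (Γ' l + 1) (by have := hΓpos l; omega)
    obtain ⟨v, hv⟩ := exists_ufrac_eq_sub_intCast (ν (Γ' l + 1) - ν (Γ' l))
    exact ⟨w - z - q * v, by rw [hd, hv]; push_cast; rw [← hz, ← hw]; ring⟩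
  have hνseg : ∀ l (j : ℕ), (j : ℤ) ≤ γ (2*l+1) →
      ν (Γ' l + j) = ufrac (ν (Γ' l) + j * d l) := fun l j hj =>
    recurrence_segment hνrec (hΓpos l) (hνval _ (hΓpos l)).1 (hνval _ (hΓpos l)).2.1
      (fun i h1 h2 => hcn i (by have := hΓpos l; omega)
        (not_breakpoint (fun j => hγ1 (2*j+1)) hΓrec l i h1 h2)) (hd l) j hj
  have hxseg' : ∀ l, x (S l) = ν (Γ' l) → x (S l - 1) = ν (Γ' l - 1) → ∀ j : ℕ,
      (j : ℤ) ≤ α (2*l+1) * n + β (2*l+1) →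
      x (S l + j) = ufrac (ν (Γ' l) + j * d l) := fun l e1 e2 j hj => by
    have e3 : x (S l + 1) = ν (Γ' l + 1) := by
      rw [hxrec _ (hSpos l), hνrec _ (hΓpos l), e1, e2, hbS _ (hSpos l) l rfl,
        hcΓ _ (hΓpos l) l rfl, haγ]
      obtain ⟨-, -, z, hz⟩ := hνval (Γ' l) (hΓpos l)
      refine ufrac_eq_of_sub_eq_intCast (z := (τ (2*l) + k * α (2*l)) * z) ?_
      push_cast; rw [← hz]; ring
    rw [← e1]
    exact recurrence_segment hxrec (hSpos l) (hxval _ (hSpos l)).1 (hxval _ (hSpos l)).2.1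
      (fun i h1 h2 => hbn i (by have := hSpos l; omega)
        (not_breakpoint (fun j => han (2*j+1)) hSrec l i h1 h2))
      (by rw [hd, e1, e3]) j hj
  have hagree : ∀ l, x (S l) = ν (Γ' l) ∧ x (S l - 1) = ν (Γ' l - 1) := fun l => by
    induction l with
    | zero => simp [hS0, hΓ0, hx0, hν0, hxm1, hνm1]
    | succ l ih =>
      have hcong : ∀ g e : ℕ, (e : ℤ) = q * (τ (2*l+1) + k * α (2*l+1)) + g →
          (g : ℤ) ≤ γ (2*l+1) → (e : ℤ) ≤ α (2*l+1) * n + β (2*l+1) →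
          x (S l + e) = ν (Γ' l + g) := fun g e h hg he => by
        rw [hxseg' l ih.1 ih.2 e he, hνseg l g hg]
        exact ufrac_add_mul_congr (hdq l) _ _ _ (τ (2*l+1) + k * α (2*l+1)) (by exact_mod_cast h)
      have hA := han (2*l+1)
      have hG := hγ1 (2*l+1)
      have hAG := haγ (2*l+1)
      rw [hSrec, hΓrec]
      generalize α (2*l+1) * n + β (2*l+1) = A at *
      generalize γ (2*l+1) = G at *
      lift A to ℕ using by omega
      lift G to ℕ using by omega
      refine ⟨hcong G A hAG le_rfl le_rfl, ?_⟩
      have := hcong (G-1) (A-1) (by push_cast [show 1 ≤ G by omega, show 1 ≤ A by omega]; linarith)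
        (by omega) (by omega)
      push_cast [show 1 ≤ G by omega, show 1 ≤ A by omega] at this
      rwa [← add_sub_assoc, ← add_sub_assoc] at this
  have hxseg := fun l => hxseg' l (hagree l).1 (hagree l).2
  have hstep : ∀ l, ∑ i ∈ Finset.Icc (1:ℤ) (S (l+1)),
        (-(B1 (x i) * B1 (x (i-1))) + (b i : ℝ)/2 * B2 (x i))
      = ∑ i ∈ Finset.Icc (1:ℤ) (S l), (-(B1 (x i) * B1 (x (i-1))) + (b i : ℝ)/2 * B2 (x i))
        + (1/12) * (6 * (((α (2*l+1) * n + β (2*l+1) : ℤ) - 1 : ℝ) * d l ^ 2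
            + (1 - 2 * d l) * ipart (ν (Γ' l) + ((α (2*l+1) * n + β (2*l+1) : ℤ) - 1 : ℝ) * d l)
            + B2 (ν (Γ' (l+1) - 1)) - B2 (ν (Γ' l)))
            - ((α (2*l+1) * n + β (2*l+1) : ℤ) - 1 : ℝ))
        + (-(B1 (ν (Γ' (l+1))) * B1 (ν (Γ' (l+1) - 1)))
            + ((α (2*(l+1)) * n + β (2*(l+1)) + 2 : ℤ) : ℝ)/2 * B2 (ν (Γ' (l+1)))) := fun l => by
    have hlast := hbS _ (hSpos (l+1)) (l+1) rfl
    have hmid : ∀ i, S l < i → i < S l + (α (2*l+1) * n + β (2*l+1)) → b i = 2 :=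
      fun i h1 h2 => hbn i (by have := hSpos l; omega)
        (not_breakpoint (fun j => han (2*j+1)) hSrec l i h1 h2)
    have hA := han (2*l+1)
    have hxl := hxseg l
    have hSl := hSrec l
    rw [← hlast, ← (hagree (l+1)).1, ← (hagree (l+1)).2]
    obtain ⟨N, hN⟩ := Int.eq_ofNat_of_zero_le (sub_nonneg.2 hA)
    obtain hN : α (2*l+1) * n + β (2*l+1) = N + 1 := by omega
    rw [hN] at hmid hxl hSl ⊢
    have key := sum_arith_progression (ν (Γ' l)) (hd0 l) (hd1 l) (fun j => x (S l + j))
      (by simpa using (hagree l).1) (hνval _ (hΓpos l)).1 (hνval _ (hΓpos l)).2.1 N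
      (fun j hj => hxl j (by omega))
    have hsum : ∑ j ∈ Finset.range N, (-(B1 (x (S l + j + 1)) * B1 (x (S l + j + 1 - 1)))
          + (b (S l + j + 1) : ℝ)/2 * B2 (x (S l + j + 1)))
        = ∑ j ∈ Finset.range N, (-(B1 (x (S l + (j+1 : ℕ))) * B1 (x (S l + j)))
          + B2 (x (S l + (j+1 : ℕ)))) := by
      refine Finset.sum_congr rfl fun j hj => ?_
      have := Finset.mem_range.1 hj
      rw [hmid _ (by omega) (by omega), add_sub_cancel_right]
      push_cast
      ring_nf
    have e1 : S (l+1) = S l + ((N+1 : ℕ) : ℤ) := by rw [hSl]; push_cast; ring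
    have e2 : S (l+1) - 1 = S l + N := by rw [hSl]; ring
    have e3 : S l + N + 1 = S (l+1) := by rw [hSl]; ring
    conv_lhs => rw [e1]
    rw [sum_Icc_one_add _ (hSpos l), Finset.sum_range_succ, hsum, key, e3, e2]
    push_cast
    ring_nf
  rw [hm]
  clear hm htodd hteven
  induction t with
  | zero => simp [hS0]
  | succ l ih =>
    rw [hstep, ih, Finset.sum_range_succ, Finset.sum_range_succ,
      Finset.sum_Icc_succ_top (by omega), Finset.sum_Icc_succ_top (by omega)]
    obtain ⟨hν0, hν1, -⟩ := hνval _ (hΓpos l)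
    have hip : ipart (ν (Γ' l) + d l * q) = d l * q := by
      obtain ⟨z, hz⟩ := hdq l
      rw [ipart, mul_comm (d l), hz, ufrac_add_intCast, ufrac_eq_self hν0 hν1]; ring
    have hipA : ipart (ν (Γ' l) + ((α (2*l+1) * n + β (2*l+1) : ℤ) - 1 : ℝ) * d l)
        = ipart (ν (Γ' l) + d l * ((γ (2*l+1) : ℝ) - 1))
          + (τ (2*l+1) + k * α (2*l+1)) * (d l * q) := by
      rw [mul_comm (d l) ((γ (2*l+1) : ℝ) - 1), ipart, ipart,
        ufrac_add_mul_congr (hdq l) _ _ ((γ (2*l+1) : ℝ) - 1) (τ (2*l+1) + k * α (2*l+1))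
          (by rw [haγ]; push_cast; ring), haγ]
      push_cast; ring
    rw [hip, hipA, haγ (2*l+1), hn']
    push_cast
    ring
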